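/- Fix integers m ≥ 1 and n ≥ 1. There is a unique polynomial q over ℚ of degree at most n such that for every natural number λ, q(λ) equals the number of functions f : Fin n → Fin λ in which every color class has cardinality at most m; moreover this polynomial satisfies q(-1) = ∑_{k=1}^{n} (-1)^k k! B_{n,k}(1_m). -/

import Mathlib

open Finset Polynomial

/-- The partial Bell polynomial `B_{n,k}(y_1, y_2, …)` of the sequence `y` (1-indexed). -/
noncomputable def bellPoly (y : ℕ → ℚ) (n k : ℕ) : ℚ :=
  ∑ α ∈ (Finset.univ : Finset (Fin n → Fin (n + 1))).filter
      (fun α => (∑ i : Fin n, (α i : ℕ)) = k ∧ (∑ i : Fin n, ((i : ℕ) + 1) * (α i : ℕ)) = n),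
    (n.factorial : ℚ) *
      ∏ i : Fin n, ((y ((i : ℕ) + 1) / (((i : ℕ) + 1).factorial : ℚ)) ^ ((α i : ℕ)) /
        (((α i : ℕ).factorial : ℚ)))

/-- The number of functions with prescribed fiber sizes is a multinomial coefficient. -/
theorem card_filter_sum_single_eq_multinomial {σ : Type*} [Fintype σ] [DecidableEq σ] {n : ℕ}
    (s : σ →₀ ℕ) (hs : ∑ c, s c = n) :
    #{f : Fin n → σ | ∑ v, Finsupp.single (f v) 1 = s} = Nat.multinomial univ s := by
  have h := MvPolynomial.coeff_linearCombination_X_pow_of_fintype (R := ℕ) (fun _ : σ => 1) s n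
  have hsum : (s.sum fun _ m => m) = n := by
    rw [Finsupp.sum_fintype _ _ fun _ => rfl, hs]
  rw [if_pos hsum, Finset.sum_pow', MvPolynomial.coeff_sum] at h
  simp only [one_smul, one_pow, Finsupp.prod, Finset.prod_const_one, mul_one, Nat.cast_id,
    Fintype.piFinset_univ] at h
  rw [Finsupp.multinomial_of_support_subset (Finset.subset_univ _), ← h, Finset.card_filter]
  refine Finset.sum_congr rfl fun f _ => ?_
  simp only [MvPolynomial.X]
  rw [← MvPolynomial.monomial_sum_one, MvPolynomial.coeff_monomial]

theorem factorial_mul_coeff_pow_eq_sum_prod_fiber (y : ℕ → ℚ) (n l : ℕ) :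
    (n.factorial : ℚ) * PowerSeries.coeff n (PowerSeries.mk (fun j => y j / j.factorial) ^ l) =
      ∑ f : Fin n → Fin l, ∏ c, y #{v | f v = c} := by
  have hfiber (f : Fin n → Fin l) (c : Fin l) :
      (∑ v, Finsupp.single (f v) 1 : Fin l →₀ ℕ) c = #{v | f v = c} := by
    simp [Finsupp.finsetSum_apply, Finsupp.single_apply]
  have hmaps : ∀ f ∈ (univ : Finset (Fin n → Fin l)),
      (∑ v, Finsupp.single (f v) 1 : Fin l →₀ ℕ) ∈ finsuppAntidiag univ n := by
    intro f _
    rw [mem_finsuppAntidiag]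
    refine ⟨?_, subset_univ _⟩
    simp only [hfiber]
    simpa using (Finset.card_eq_sum_card_fiberwise
      (f := f) (s := univ) (t := univ) fun _ _ => by simp).symm
  rw [← Finset.sum_fiberwise_of_maps_to hmaps]
  have hpow : PowerSeries.mk (fun j => y j / j.factorial) ^ l =
      ∏ _c : Fin l, PowerSeries.mk (fun j => y j / (j.factorial : ℚ)) := by simp
  rw [hpow, PowerSeries.coeff_prod, Finset.mul_sum]
  refine Finset.sum_congr rfl fun s hs => ?_
  have hs' : ∑ c, s c = n := (mem_finsuppAntidiag.1 hs).1
  rw [Finset.sum_congr rfl (g := fun _ => ∏ c, y (s c)) fun f hf => by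
    simp only [← (Finset.mem_filter.1 hf).2, hfiber]]
  rw [Finset.sum_const, card_filter_sum_single_eq_multinomial s hs', nsmul_eq_mul]
  have hspec := Nat.multinomial_spec (univ : Finset (Fin l)) s
  rw [hs'] at hspec
  have hne : (∏ c, ((s c).factorial : ℚ)) ≠ 0 :=
    Finset.prod_ne_zero_iff.2 fun c _ => by positivity
  simp only [PowerSeries.coeff_mk, Finset.prod_div_distrib]
  rw [← hspec]
  push_cast
  field_simp

theorem factorial_mul_coeff_pow_eq_bellPoly (y : ℕ → ℚ) (n k : ℕ) :
    (n.factorial : ℚ) * PowerSeries.coeff n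
        (PowerSeries.mk (fun j => if j = 0 then 0 else y j / j.factorial) ^ k) =
      k.factorial * bellPoly y n k := by
  set F : PowerSeries ℚ := PowerSeries.mk (fun j => if j = 0 then 0 else y j / j.factorial)
  let c (i : Fin n) : ℚ := y (i + 1) / ((i : ℕ) + 1).factorial
  let P : PowerSeries ℚ := ∑ i : Fin n, PowerSeries.monomial ((i : ℕ) + 1) (c i)
  have hFP : (PowerSeries.X : PowerSeries ℚ) ^ (n + 1) ∣ F - P := by
    rw [PowerSeries.X_pow_dvd_iff]
    intro d hd
    simp only [F, P, c, map_sub, PowerSeries.coeff_mk, map_sum, PowerSeries.coeff_monomial]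
    rcases d with _ | d
    · simp
    · rw [Finset.sum_eq_single (⟨d, by omega⟩ : Fin n)]
      · simp
      · intro i _ hi
        rw [if_neg]
        intro h
        exact hi (Fin.ext (by simp; omega))
      · simp
  have hcoeff : PowerSeries.coeff n (F ^ k) = PowerSeries.coeff n (P ^ k) := by
    have := PowerSeries.X_pow_dvd_iff.1 (hFP.trans (sub_dvd_pow_sub_pow F P k)) n n.lt_succ_self
    rwa [map_sub, sub_eq_zero] at this
  have hmon (α : Fin n → ℕ) : PowerSeries.coeff n ((Nat.multinomial univ α : PowerSeries ℚ) *
      ∏ i : Fin n, PowerSeries.monomial ((i : ℕ) + 1) (c i) ^ α i) =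
        if ∑ i : Fin n, ((i : ℕ) + 1) * α i = n then
          (Nat.multinomial univ α : ℚ) * ∏ i, c i ^ α i else 0 := by
    simp only [PowerSeries.monomial_pow, PowerSeries.prod_monomial]
    rw [← map_natCast (PowerSeries.C (R := ℚ)), PowerSeries.coeff_C_mul,
      PowerSeries.coeff_monomial]
    simp only [mul_comm (α _), eq_comm (a := n), mul_ite, mul_zero]
  rw [hcoeff, Finset.sum_pow_eq_sum_piAntidiag, map_sum]
  simp only [hmon]
  rw [← Finset.sum_filter, bellPoly, Finset.mul_sum, Finset.mul_sum]
  symm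
  refine Finset.sum_bij (fun α _ i => (α i : ℕ)) ?_ ?_ ?_ ?_
  · intro α hα
    simpa using hα
  · intro α _ β _ h
    ext i
    exact congrFun h i
  · intro β hβ
    simp only [mem_filter, mem_piAntidiag, mem_univ, implies_true, and_true] at hβ
    have hle (i : Fin n) : β i < n + 1 := by
      have := Finset.single_le_sum (f := fun i : Fin n => ((i : ℕ) + 1) * β i)
        (fun _ _ => Nat.zero_le _) (mem_univ i)
      simp only [hβ.2] at this
      nlinarith
    exact ⟨fun i => ⟨β i, hle i⟩, by simpa using hβ, rfl⟩
  · intro α hα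
    have hspec := Nat.multinomial_spec (univ : Finset (Fin n)) fun i => (α i : ℕ)
    rw [(Finset.mem_filter.1 hα).2.1] at hspec
    have hne : (∏ i, ((α i : ℕ).factorial : ℚ)) ≠ 0 :=
      Finset.prod_ne_zero_iff.2 fun c _ => by positivity
    simp only [Finset.prod_div_distrib (g := fun i => ((α i : ℕ).factorial : ℚ)), c]
    rw [← hspec]
    push_cast
    field_simp

theorem bellPoly_eq_zero_of_lt (y : ℕ → ℚ) {n k : ℕ} (h : n < k) : bellPoly y n k = 0 := by
  refine Finset.sum_eq_zero fun α hα => ?_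
  obtain ⟨-, h₁, h₂⟩ := Finset.mem_filter.1 hα
  have : ∑ i : Fin n, (α i : ℕ) ≤ ∑ i : Fin n, ((i : ℕ) + 1) * (α i : ℕ) :=
    Finset.sum_le_sum fun i _ => Nat.le_mul_of_pos_left _ (Nat.succ_pos _)
  omega

theorem bellPoly_zero_right (y : ℕ → ℚ) {n : ℕ} (hn : n ≠ 0) : bellPoly y n 0 = 0 := by
  refine Finset.sum_eq_zero fun α hα => ?_
  obtain ⟨-, h₁, h₂⟩ := Finset.mem_filter.1 hα
  rw [Finset.sum_eq_zero_iff] at h₁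
  rw [Finset.sum_eq_zero fun i hi => by rw [h₁ i hi, mul_zero]] at h₂
  exact absurd h₂.symm hn

theorem sum_prod_fiber_eq_sum_descFactorial_mul_bellPoly (y : ℕ → ℚ) (hy : y 0 = 1) (n l : ℕ) :
    ∑ f : Fin n → Fin l, ∏ c, y #{v | f v = c} =
      ∑ k ∈ range (n + 1), (l.descFactorial k : ℚ) * bellPoly y n k := by
  have hF : PowerSeries.mk (fun j => y j / (j.factorial : ℚ)) =
      PowerSeries.mk (fun j => if j = 0 then 0 else y j / (j.factorial : ℚ)) + 1 := by
    ext j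
    by_cases hj : j = 0 <;> simp [hj, hy, PowerSeries.coeff_one]
  have hterm (k : ℕ) : (n.factorial : ℚ) * PowerSeries.coeff n
      (PowerSeries.mk (fun j => if j = 0 then 0 else y j / (j.factorial : ℚ)) ^ k *
        (l.choose k : PowerSeries ℚ)) = (l.descFactorial k : ℚ) * bellPoly y n k := by
    rw [← map_natCast (PowerSeries.C (R := ℚ)), PowerSeries.coeff_mul_C, ← mul_assoc,
      factorial_mul_coeff_pow_eq_bellPoly, Nat.descFactorial_eq_factorial_mul_choose]
    push_cast
    ring
  rw [← factorial_mul_coeff_pow_eq_sum_prod_fiber, hF, add_pow, map_sum, Finset.mul_sum]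
  simp only [one_pow, mul_one, hterm]
  rcases le_total l n with h | h
  · refine Finset.sum_subset (range_subset_range.2 (by omega)) fun k _ hk => ?_
    rw [Nat.descFactorial_of_lt (by rw [mem_range] at hk; omega), Nat.cast_zero,
      zero_mul]
  · refine (Finset.sum_subset (range_subset_range.2 (by omega)) fun k _ hk => ?_).symm
    rw [bellPoly_eq_zero_of_lt y (by rw [mem_range] at hk; omega), mul_zero]

theorem natCard_coloring_eq_sum_prod_fiber (m n l : ℕ) :
    (Nat.card {f : Fin n → Fin l // ∀ c : Fin l, #{v | f v = c} ≤ m} : ℚ) =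
      ∑ f : Fin n → Fin l, ∏ c, if #{v | f v = c} ≤ m then (1 : ℚ) else 0 := by
  rw [Nat.card_eq_fintype_card, Fintype.card_subtype, Finset.card_filter]
  push_cast
  refine Finset.sum_congr rfl fun f _ => ?_
  rw [Finset.prod_ite_zero]
  simp

theorem descPochhammer_eval_neg_one (k : ℕ) :
    (descPochhammer ℚ k).eval (-1) = (-1) ^ k * k.factorial := by
  induction k with
  | zero => simp
  | succ k ih =>
    rw [descPochhammer_succ_eval, ih, Nat.factorial_succ]
    push_cast
    ring

theorem eq_of_eval_natCast_eq {p q : ℚ[X]}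
    (h : ∀ l : ℕ, p.eval (l : ℚ) = q.eval (l : ℚ)) : p = q :=
  eq_of_infinite_eval_eq p q <|
    (Set.infinite_range_of_injective (Nat.cast_injective (R := ℚ))).mono <| by
      rintro _ ⟨l, rfl⟩
      exact h l

/-- There is a unique polynomial `q` over `ℚ` of degree at most `n` whose value at
every natural number `l` is the number of colorings `f : Fin n → Fin l` in which each
color is used at most `m` times (the degree-chromatic polynomial `χ_m(K_n, ·)`);
moreover this polynomial satisfies `q(-1) = ∑_{k=1}^{n} (-1)^k k! B_{n,k}(1_m)`. -/
theorem degree_chromatic_poly_complete_graph (m n : ℕ) (hm : 1 ≤ m) (hn : 1 ≤ n) :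
    (∃! q : Polynomial ℚ, q.natDegree ≤ n ∧
        ∀ l : ℕ, q.eval (l : ℚ) =
          Nat.card {f : Fin n → Fin l //
            ∀ c : Fin l, (Finset.univ.filter (fun v => f v = c)).card ≤ m}) ∧
      ∀ q : Polynomial ℚ, (q.natDegree ≤ n ∧
          ∀ l : ℕ, q.eval (l : ℚ) =
            Nat.card {f : Fin n → Fin l //
              ∀ c : Fin l, (Finset.univ.filter (fun v => f v = c)).card ≤ m}) →
        q.eval (-1 : ℚ) =
          ∑ k ∈ Finset.Icc 1 n, (-1 : ℚ) ^ k * (k.factorial : ℚ) *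
            bellPoly (fun i => if i ≤ m then 1 else 0) n k := by
  let y : ℕ → ℚ := fun i => if i ≤ m then 1 else 0
  let p : ℚ[X] := ∑ k ∈ range (n + 1), descPochhammer ℚ k * C (bellPoly y n k)
  have hdeg : p.natDegree ≤ n := by
    refine natDegree_sum_le_of_forall_le _ _ fun k hk => (natDegree_mul_C_le _ _).trans ?_
    rw [descPochhammer_natDegree]
    exact Nat.lt_succ_iff.1 (mem_range.1 hk)
  have heval (l : ℕ) : p.eval (l : ℚ) = Nat.card {f : Fin n → Fin l //
      ∀ c : Fin l, (Finset.univ.filter (fun v => f v = c)).card ≤ m} := by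
    rw [natCard_coloring_eq_sum_prod_fiber,
      sum_prod_fiber_eq_sum_descFactorial_mul_bellPoly y (by simp [y])]
    simp [p, eval_finsetSum, descPochhammer_eval_eq_descFactorial]
  have huniq (q : ℚ[X]) (hq : ∀ l : ℕ, q.eval (l : ℚ) = Nat.card {f : Fin n → Fin l //
      ∀ c : Fin l, (Finset.univ.filter (fun v => f v = c)).card ≤ m}) : q = p :=
    eq_of_eval_natCast_eq fun l => (hq l).trans (heval l).symm
  refine ⟨⟨p, ⟨hdeg, heval⟩, fun q hq => huniq q hq.2⟩, fun q hq => ?_⟩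
  rw [huniq q hq.2]
  simp only [p, eval_finsetSum, eval_mul, eval_C, descPochhammer_eval_neg_one]
  refine (Finset.sum_subset (fun k hk => ?_) fun k hk hk' => ?_).symm
  · rw [mem_Icc] at hk
    exact mem_range.2 (by omega)
  · have hk0 : k = 0 := by
      rw [mem_range] at hk
      rw [mem_Icc] at hk'
      omega
    rw [hk0, bellPoly_zero_right y (by omega), mul_zero]
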